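/- There exists a constant C > 0 such that for every prime q, every positive integer n, every nonempty set A ⊆ 𝔽_q^n with density α = |A|/q^n, and every γ ∈ (0,1], there is an affine subspace V ⊆ 𝔽_q^n (a coset of a linear subspace) of codimension at most C·⌞α⌟^5·⌞γ⌟^2 such that |(A+A) ∩ V| ≥ (1−γ)·|V|. -/

import Mathlib

open Finset Pointwise

noncomputable section

/-- `lo δ = log (2/δ)`. -/
def lo (δ : ℝ) : ℝ := Real.log (2 / δ)

/-- The coset `v + W` of a linear subspace, as a finset. -/
def affineCoset {q n : ℕ} [Fact q.Prime] (W : Submodule (ZMod q) (Fin n → ZMod q))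
    (v : Fin n → ZMod q) : Finset (Fin n → ZMod q) :=
  letI := Classical.decPred (fun x : Fin n → ZMod q => x - v ∈ W)
  Finset.univ.filter (fun x => x - v ∈ W)



/-- real indicator -/
noncomputable def kmInd {G : Type} (A : Finset G) (x : G) : ℝ :=
  open Classical in if x ∈ A then 1 else 0

lemma kmInd_nonneg {G : Type} (A : Finset G) (x : G) : 0 ≤ kmInd A x := by
  unfold kmInd; split_ifs <;> norm_num

lemma kmInd_sum {G : Type} [Fintype G] (A : Finset G) (f : G → ℝ) :
    ∑ x, kmInd A x * f x = ∑ x ∈ A, f x := by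
  classical
  unfold kmInd
  simp [Finset.sum_ite_mem]

lemma kmInd_sum_one {G : Type} [Fintype G] (A : Finset G) :
    ∑ x, kmInd A x = (A.card : ℝ) := by
  have := kmInd_sum A (fun _ => 1)
  simpa using this

/-- difference correlation -/
noncomputable def kmD {G : Type} [AddCommGroup G] [Fintype G] (A : Finset G) (x : G) : ℝ :=
  ∑ y, kmInd A y * kmInd A (x + y)

lemma kmD_nonneg {G : Type} [AddCommGroup G] [Fintype G] (A : Finset G) (x : G) :
    0 ≤ kmD A x :=
  Finset.sum_nonneg fun _ _ => mul_nonneg (kmInd_nonneg _ _) (kmInd_nonneg _ _)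

lemma km_moment {G : Type} [AddCommGroup G] [Fintype G] (g : G → ℝ) (k : ℕ) :
    |∑ x, (∑ y, g y * g (x - y)) ^ k| ≤ ∑ x, (∑ y, g y * g (x + y)) ^ k := by
  classical
  have e1 : ∀ x, (∑ y, g y * g (x - y)) ^ k
      = ∑ y : Fin k → G, (∏ i, g (y i)) * ∏ i, g (x - y i) := by
    intro x
    rw [Fintype.sum_pow]
    simp [Finset.prod_mul_distrib]
  have e2 : ∀ x, (∑ y, g y * g (x + y)) ^ k
      = ∑ y : Fin k → G, (∏ i, g (y i)) * ∏ i, g (x + y i) := by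
    intro x
    rw [Fintype.sum_pow]
    simp [Finset.prod_mul_distrib]
  simp_rw [e1, e2]
  set h : (Fin k → G) → ℝ := fun y => ∑ t : G, ∏ i, g (y i + t) with hh
  have hN : (0 : ℝ) < Fintype.card G := by exact_mod_cast Fintype.card_pos
  have a1 : ∑ y, h y * h y = (Fintype.card G : ℝ) *
      ∑ x, ∑ y : Fin k → G, (∏ i, g (y i)) * ∏ i, g (x + y i) := by
    have : ∀ t : G, ∑ x, ∑ y : Fin k → G, (∏ i, g (y i)) * ∏ i, g (x + y i)
        = ∑ s, ∑ y : Fin k → G, (∏ i, g (y i + t)) * ∏ i, g (y i + s) := by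
      intro t
      refine Fintype.sum_equiv (Equiv.addRight t) _ _ ?_
      intro x
      refine (Fintype.sum_equiv (Equiv.addRight (fun _ : Fin k => t)) _ _ ?_).symm
      intro y
      simp only [Equiv.coe_addRight, Pi.add_apply]
      congr 1
      refine Finset.prod_congr rfl fun i _ => ?_
      congr 1; abel
    rw [← nsmul_eq_mul, ← Finset.card_univ, ← Finset.sum_const, Finset.sum_congr rfl (fun t _ => this t)]
    simp only [hh, Finset.sum_mul_sum]
    rw [Finset.sum_comm]
    refine Finset.sum_congr rfl fun t _ => ?_
    rw [Finset.sum_comm]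
  have a2 : ∑ y, h y * h (-y) = (Fintype.card G : ℝ) *
      ∑ x, ∑ y : Fin k → G, (∏ i, g (y i)) * ∏ i, g (x - y i) := by
    have : ∀ t : G, ∑ x, ∑ y : Fin k → G, (∏ i, g (y i)) * ∏ i, g (x - y i)
        = ∑ s, ∑ y : Fin k → G, (∏ i, g (y i + t)) * ∏ i, g (- y i + s) := by
      intro t
      refine (Fintype.sum_equiv (Equiv.addRight t) _ _ ?_).symm
      intro x
      refine (Fintype.sum_equiv (Equiv.addRight (fun _ : Fin k => t)) _ _ ?_)
      intro y
      simp only [Equiv.coe_addRight, Pi.add_apply]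
      congr 1
      refine Finset.prod_congr rfl fun i _ => ?_
      congr 1; abel
    rw [← nsmul_eq_mul, ← Finset.card_univ, ← Finset.sum_const, Finset.sum_congr rfl (fun t _ => this t)]
    simp only [hh, Finset.sum_mul_sum, Pi.neg_apply]
    rw [Finset.sum_comm]
    refine Finset.sum_congr rfl fun t _ => ?_
    rw [Finset.sum_comm]
  have a3 : ∑ y, h (-y) * h (-y) = ∑ y, h y * h y :=
    Fintype.sum_equiv (Equiv.neg _) _ _ (fun y => rfl)
  have a4 : |∑ y, h y * h (-y)| ≤ ∑ y, h y * h y := by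
    rw [abs_le]
    have p1 : 0 ≤ ∑ y, (h y + h (-y)) ^ 2 := Finset.sum_nonneg fun _ _ => sq_nonneg _
    have p2 : 0 ≤ ∑ y, (h y - h (-y)) ^ 2 := Finset.sum_nonneg fun _ _ => sq_nonneg _
    have q1 : ∑ y, (h y + h (-y)) ^ 2 = ∑ y, h y * h y + 2 * ∑ y, h y * h (-y) + ∑ y, h (-y) * h (-y) := by
      rw [Finset.mul_sum, ← Finset.sum_add_distrib, ← Finset.sum_add_distrib]
      exact Finset.sum_congr rfl fun _ _ => by ring
    have q2 : ∑ y, (h y - h (-y)) ^ 2 = ∑ y, h y * h y - 2 * ∑ y, h y * h (-y) + ∑ y, h (-y) * h (-y) := by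
      rw [Finset.mul_sum, ← Finset.sum_sub_distrib, ← Finset.sum_add_distrib]
      exact Finset.sum_congr rfl fun _ _ => by ring
    constructor <;> linarith
  rw [a1, a2, abs_mul, abs_of_pos hN] at a4
  exact le_of_mul_le_mul_left a4 hN

/-- If `C` is disjoint from `A + A`, high moments of the difference correlation are large. -/
lemma km_lift {G : Type} [AddCommGroup G] [Fintype G] (A C : Finset G) (m : ℕ)
    (hm : Even m)
    (hC : ∀ x ∈ C, ∀ a ∈ A, ∀ b ∈ A, a + b ≠ x) :
    (C.card : ℝ) * (2 * ((A.card : ℝ) ^ 2 / Fintype.card G)) ^ m ≤ ∑ x, kmD A x ^ m := by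
  classical
  have hN : (0 : ℝ) < Fintype.card G := by exact_mod_cast Fintype.card_pos
  set N : ℝ := ((Fintype.card G : ℕ) : ℝ) with hNdef
  set α : ℝ := A.card / N with hα
  set κ : ℝ := (A.card : ℝ) ^ 2 / N with hκ
  set g : G → ℝ := fun x => kmInd A x - α with hg
  have hκ0 : 0 ≤ κ := by positivity
  have hs : ∑ x, kmInd A x = N * α := by rw [kmInd_sum_one, hα]; field_simp
  have hκα : κ = α * (N * α) := by rw [hκ, hα]; field_simp
  have hF : ∀ x, ∑ y, g y * g (x - y) = ∑ y, kmInd A y * kmInd A (x - y) - κ := by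
    intro x
    have h2 : ∑ y, kmInd A (x - y) = N * α := by
      rw [← hs]; exact Fintype.sum_equiv (Equiv.subLeft x) _ _ (fun _ => rfl)
    have : ∀ y, g y * g (x - y) = kmInd A y * kmInd A (x - y) - α * kmInd A y
        - α * kmInd A (x - y) + α * α := by intro y; simp only [hg]; ring
    simp_rw [this, Finset.sum_add_distrib, Finset.sum_sub_distrib, ← Finset.mul_sum, hs, h2]
    simp only [Finset.sum_const, Finset.card_univ, nsmul_eq_mul, ← hNdef]
    rw [hκα]; ring
  have hD : ∀ x, ∑ y, g y * g (x + y) = kmD A x - κ := by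
    intro x
    have h2 : ∑ y, kmInd A (x + y) = N * α := by
      rw [← hs]; exact Fintype.sum_equiv (Equiv.addLeft x) _ _ (fun _ => rfl)
    have : ∀ y, g y * g (x + y) = kmInd A y * kmInd A (x + y) - α * kmInd A y
        - α * kmInd A (x + y) + α * α := by intro y; simp only [hg]; ring
    simp_rw [this, Finset.sum_add_distrib, Finset.sum_sub_distrib, ← Finset.mul_sum, hs, h2]
    simp only [Finset.sum_const, Finset.card_univ, nsmul_eq_mul, ← hNdef]
    rw [hκα, kmD]; ring
  set F : G → ℝ := fun x => ∑ y, g y * g (x - y) with hFd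
  set E : G → ℝ := fun x => ∑ y, g y * g (x + y) with hEd
  have b1 : ∑ x, kmD A x ^ m = ∑ j ∈ range (m + 1), (∑ x, E x ^ j) * κ ^ (m - j) * (m.choose j) := by
    have : ∀ x, kmD A x ^ m = ∑ j ∈ range (m + 1), E x ^ j * κ ^ (m - j) * (m.choose j) := by
      intro x
      rw [← add_pow, hEd]; simp only [hD]; ring
    simp_rw [this]
    rw [Finset.sum_comm]
    simp_rw [Finset.sum_mul]
  have b2 : ∑ x, (- F x + κ) ^ m = ∑ j ∈ range (m + 1), (∑ x, (- F x) ^ j) * κ ^ (m - j) * (m.choose j) := by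
    simp_rw [add_pow]
    rw [Finset.sum_comm]
    simp_rw [Finset.sum_mul]
  have b3 : ∑ x, (- F x + κ) ^ m ≤ ∑ x, kmD A x ^ m := by
    rw [b1, b2]
    refine Finset.sum_le_sum fun j _ => ?_
    have : ∑ x, (- F x) ^ j ≤ ∑ x, E x ^ j := by
      refine le_trans ?_ (km_moment g j)
      have : ∑ x, (-F x) ^ j = (-1) ^ j * ∑ x, F x ^ j := by
        rw [Finset.mul_sum]; exact Finset.sum_congr rfl fun x _ => by rw [neg_pow]
      rw [this]
      refine le_trans (le_abs_self _) ?_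
      rw [abs_mul]; simp [hFd]
    gcongr
  refine le_trans ?_ b3
  have : ∑ x ∈ C, (- F x + κ) ^ m = C.card * (2 * κ) ^ m := by
    rw [← nsmul_eq_mul, ← Finset.sum_const]
    refine Finset.sum_congr rfl fun x hx => ?_
    have : F x = - κ := by
      simp only [hFd, hF]
      have : ∑ y, kmInd A y * kmInd A (x - y) = 0 := by
        refine Finset.sum_eq_zero fun y _ => ?_
        unfold kmInd
        by_cases h1 : y ∈ A
        · by_cases h2 : x - y ∈ A
          · exact absurd (by abel) (hC x hx y h1 (x - y) h2)
          · simp [h2]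
        · simp [h1]
      rw [this]; ring
    rw [this]; ring
  rw [← this]
  exact Finset.sum_le_sum_of_subset_of_nonneg (Finset.subset_univ _) fun x _ _ => hm.pow_nonneg _


lemma km_sift_id {G : Type} [AddCommGroup G] [Fintype G] [DecidableEq G] (A : Finset G) (m : ℕ)
    (w : G → ℝ) :
    ∑ s : Fin m → G, ∑ u ∈ univ.filter (fun u => ∀ i, u + s i ∈ A),
      ∑ v ∈ univ.filter (fun u => ∀ i, u + s i ∈ A), w (v - u)
      = Fintype.card G * ∑ x, w x * kmD A x ^ m := by
  classical
  have h0 : ∀ (s : Fin m → G) (u : G),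
      kmInd (univ.filter (fun u => ∀ i, u + s i ∈ A)) u = ∏ i, kmInd A (u + s i) := by
    intro s u
    unfold kmInd
    by_cases hu : ∀ i, u + s i ∈ A
    · simp [hu]
    · obtain ⟨i, hi⟩ := not_forall.mp hu
      rw [Finset.prod_eq_zero (Finset.mem_univ i) (by simp [hi])]
      simp [hu]
  have h1 : ∀ s : Fin m → G, ∑ u ∈ univ.filter (fun u => ∀ i, u + s i ∈ A),
      ∑ v ∈ univ.filter (fun u => ∀ i, u + s i ∈ A), w (v - u)
      = ∑ u, ∑ v, w (v - u) * ∏ i, (kmInd A (u + s i) * kmInd A (v + s i)) := by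
    intro s
    rw [← kmInd_sum]
    refine Finset.sum_congr rfl fun u _ => ?_
    rw [← kmInd_sum, Finset.mul_sum]
    refine Finset.sum_congr rfl fun v _ => ?_
    rw [h0, h0, Finset.prod_mul_distrib]; ring
  simp_rw [h1]
  rw [Finset.sum_comm]
  rw [← nsmul_eq_mul, ← Finset.card_univ, ← Finset.sum_const]
  refine Finset.sum_congr rfl fun u _ => ?_
  rw [Finset.sum_comm]
  refine Fintype.sum_equiv (Equiv.subRight u) _ _ ?_
  intro v
  rw [← Finset.mul_sum]
  simp only [Equiv.subRight_apply]
  congr 1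
  rw [← Fintype.sum_pow (fun t => kmInd A (u + t) * kmInd A (v + t))]
  congr 1
  unfold kmD
  refine Fintype.sum_equiv (Equiv.addLeft u) _ _ ?_
  intro t
  simp only [Equiv.coe_addLeft]
  congr 2; abel

lemma km_sift {G : Type} [AddCommGroup G] [Fintype G] [DecidableEq G] (A : Finset G)
    (hA : A.Nonempty) (m : ℕ) (hm : 24 ≤ m)
    (h : (Fintype.card G : ℝ) * ((3 / 2) * ((A.card : ℝ) ^ 2 / Fintype.card G)) ^ m
      ≤ ∑ x, kmD A x ^ m) :
    ∃ B : Finset G, B.Nonempty ∧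
      ((A.card : ℝ) / Fintype.card G) ^ m * Fintype.card G ≤ B.card ∧
      (19 / 20) * (B.card : ℝ) ^ 2 ≤ ∑ u ∈ B, ∑ v ∈ B,
        (if (5 / 4) * ((A.card : ℝ) ^ 2 / Fintype.card G) ≤ kmD A (v - u) then (1:ℝ) else 0) := by
  classical
  have hN : (0 : ℝ) < Fintype.card G := by exact_mod_cast Fintype.card_pos
  have hA0 : (0 : ℝ) < A.card := by exact_mod_cast hA.card_pos
  set N : ℝ := ((Fintype.card G : ℕ) : ℝ) with hNdef
  set κ : ℝ := (A.card : ℝ) ^ 2 / N with hκ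
  have hκ0 : 0 < κ := by positivity
  set w : G → ℝ := fun x => if (5 / 4) * κ ≤ kmD A x then 1 else -19 with hw
  have hid := km_sift_id A m w
  set M : ℝ := ∑ x, kmD A x ^ m with hM
  have h1 : M / 2 ≤ ∑ x, w x * kmD A x ^ m := by
    have p1 : ∀ x, kmD A x ^ m - 20 * ((5 / 4) * κ) ^ m ≤ w x * kmD A x ^ m := by
      intro x
      simp only [hw]
      split_ifs with hx
      · have : 0 ≤ ((5 / 4) * κ) ^ m := by positivity
        linarith
      · have := pow_le_pow_left₀ (kmD_nonneg A x) (not_le.mp hx).le m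
        linarith
    have p2 := Finset.sum_le_sum fun x (_ : x ∈ univ) => p1 x
    rw [Finset.sum_sub_distrib, ← hM] at p2
    simp only [Finset.sum_const, Finset.card_univ, nsmul_eq_mul, ← hNdef] at p2
    have p3 : (40 : ℝ) ≤ (6 / 5) ^ m := by
      calc (40:ℝ) ≤ (6 / 5) ^ 24 := by norm_num
        _ ≤ _ := pow_le_pow_right₀ (by norm_num) hm
    have p4 : 40 * ((5 / 4) * κ) ^ m ≤ ((3 / 2) * κ) ^ m := by
      have : (3 / 2) * κ = (6 / 5) * ((5 / 4) * κ) := by ring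
      rw [this, mul_pow (6 / 5 : ℝ)]
      exact mul_le_mul_of_nonneg_right p3 (by positivity)
    have p5 : N * (40 * ((5 / 4) * κ) ^ m) ≤ M := le_trans (by gcongr) h
    linarith
  have hlow : ∃ s : Fin m → G, (((A.card : ℝ) / N) ^ m * N) ^ 2 ≤
      ∑ u ∈ univ.filter (fun u => ∀ i, u + s i ∈ A),
      ∑ v ∈ univ.filter (fun u => ∀ i, u + s i ∈ A), w (v - u) := by
    by_contra hcon
    push Not at hcon
    have q := Finset.sum_lt_sum_of_nonempty (s := (univ : Finset (Fin m → G))) ⟨0, by simp⟩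
      (fun s _ => hcon s)
    rw [hid] at q
    simp only [Finset.sum_const, Finset.card_univ, nsmul_eq_mul, Fintype.card_pi_const] at q
    push_cast at q
    rw [← hNdef] at q
    have q2 : N * (N * (3 / 2 * κ) ^ m / 2) ≤ N * ∑ x, w x * kmD A x ^ m := by
      gcongr; linarith
    have q3 : (2:ℝ) ≤ (3 / 2) ^ m := by
      calc (2:ℝ) ≤ (3 / 2) ^ 24 := by norm_num
        _ ≤ _ := pow_le_pow_right₀ (by norm_num) hm
    have q4 : N ^ m * (((A.card : ℝ) / N) ^ m * N) ^ 2 = N * (N * κ ^ m) := by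
      have : κ = N * ((A.card : ℝ) / N) ^ 2 := by rw [hκ]; field_simp
      rw [this, mul_pow]; ring
    have q5 : N * (N * κ ^ m) ≤ N * (N * (3 / 2 * κ) ^ m / 2) := by
      have : (0:ℝ) < κ ^ m := by positivity
      rw [mul_pow]
      have : N * κ ^ m ≤ N * ((3 / 2) ^ m * κ ^ m) / 2 := by
        nlinarith [mul_pos hN this]
      gcongr
    linarith
  obtain ⟨s, hs⟩ := hlow
  set B := univ.filter (fun u => ∀ i, u + s i ∈ A) with hB
  have hpos : (0:ℝ) < (((A.card : ℝ) / N) ^ m * N) := by positivity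
  have hw2 : ∀ x, w x = 20 * (if (5 / 4) * κ ≤ kmD A x then (1:ℝ) else 0) - 19 := by
    intro x; simp only [hw]; split_ifs <;> norm_num
  have hsum : ∑ u ∈ B, ∑ v ∈ B, w (v - u) = 20 * ∑ u ∈ B, ∑ v ∈ B,
        (if (5 / 4) * κ ≤ kmD A (v - u) then (1:ℝ) else 0) - 19 * (B.card : ℝ) ^ 2 := by
    simp_rw [hw2, Finset.sum_sub_distrib, ← Finset.mul_sum]
    simp only [Finset.sum_const, nsmul_eq_mul]
    ring
  have hle : ∑ u ∈ B, ∑ v ∈ B, w (v - u) ≤ (B.card : ℝ) ^ 2 := by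
    calc _ ≤ ∑ u ∈ B, ∑ v ∈ B, (1:ℝ) := by
          refine Finset.sum_le_sum fun u _ => Finset.sum_le_sum fun v _ => ?_
          simp only [hw]; split_ifs <;> norm_num
      _ = _ := by simp; ring
  have hcard : (((A.card : ℝ) / N) ^ m * N) ≤ B.card :=
    le_of_sq_le_sq (le_trans hs hle) (by positivity)
  refine ⟨B, ?_, hcard, ?_⟩
  · rw [← Finset.card_pos]
    exact_mod_cast lt_of_lt_of_le hpos hcard
  · have : 0 ≤ (((A.card : ℝ) / N) ^ m * N) ^ 2 := by positivity
    linarith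

lemma km_exp_conv (l x : ℝ) (hx : |x| ≤ 1) :
    Real.exp (l * x) ≤ Real.cosh l + x * Real.sinh l := by
  have hx := abs_le.mp hx
  have h := convexOn_exp.2 (Set.mem_univ l) (Set.mem_univ (-l))
    (show 0 ≤ (1 + x) / 2 by linarith) (show 0 ≤ (1 - x) / 2 by linarith) (by ring)
  simp only [smul_eq_mul] at h
  have e : (1 + x) / 2 * l + (1 - x) / 2 * (-l) = l * x := by ring
  rw [e] at h
  rw [Real.cosh_eq, Real.sinh_eq]
  linarith

/-- one-sided Hoeffding -/
lemma km_hoeff {G : Type} [DecidableEq G] (B : Finset G) (f : G → ℝ) (hf : ∀ v ∈ B, |f v| ≤ 1)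
    (h0 : ∑ v ∈ B, f v = 0) (l : ℕ) (ε : ℝ) (hε : 0 ≤ ε) :
    (((Fintype.piFinset fun _ : Fin l => B).filter (fun v => l * ε < ∑ i, f (v i))).card : ℝ)
      ≤ Real.exp (- (l * ε ^ 2 / 2)) * (B.card : ℝ) ^ l := by
  have h1 : ∑ v ∈ Fintype.piFinset fun _ : Fin l => B, Real.exp (ε * ∑ i, f (v i))
      ≤ Real.exp (l * ε ^ 2 / 2) * (B.card : ℝ) ^ l := by
    have : ∀ v : Fin l → G, Real.exp (ε * ∑ i, f (v i)) = ∏ i, Real.exp (ε * f (v i)) := by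
      intro v; rw [Finset.mul_sum, Real.exp_sum]
    simp_rw [this]
    rw [← Finset.sum_pow' B (fun x => Real.exp (ε * f x)) l]
    have h2 : ∑ x ∈ B, Real.exp (ε * f x) ≤ Real.exp (ε ^ 2 / 2) * B.card := by
      calc _ ≤ ∑ x ∈ B, (Real.cosh ε + f x * Real.sinh ε) :=
            Finset.sum_le_sum fun x hx => km_exp_conv _ _ (hf x hx)
        _ = Real.cosh ε * B.card := by
            rw [Finset.sum_add_distrib, ← Finset.sum_mul, h0]; simp; ring
        _ ≤ _ := by gcongr; exact Real.cosh_le_exp_half_sq ε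
    calc _ ≤ (Real.exp (ε ^ 2 / 2) * B.card) ^ l :=
          pow_le_pow_left₀ (Finset.sum_nonneg fun _ _ => (Real.exp_pos _).le) h2 l
      _ = _ := by rw [mul_pow, ← Real.exp_nat_mul]; congr 2; ring
  set S := (Fintype.piFinset fun _ : Fin l => B).filter (fun v => l * ε < ∑ i, f (v i)) with hS
  have h3 : (S.card : ℝ) * Real.exp (l * ε ^ 2) ≤
      ∑ v ∈ Fintype.piFinset fun _ : Fin l => B, Real.exp (ε * ∑ i, f (v i)) := by
    calc _ = ∑ v ∈ S, Real.exp (l * ε ^ 2) := by simp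
      _ ≤ ∑ v ∈ S, Real.exp (ε * ∑ i, f (v i)) := by
          refine Finset.sum_le_sum fun v hv => Real.exp_le_exp.mpr ?_
          have := (Finset.mem_filter.mp hv).2
          nlinarith
      _ ≤ _ := Finset.sum_le_sum_of_subset_of_nonneg (Finset.filter_subset _ _)
          fun _ _ _ => (Real.exp_pos _).le
  have h4 := h3.trans h1
  have e : Real.exp (l * ε ^ 2) = Real.exp (l * ε ^ 2 / 2) * Real.exp (l * ε ^ 2 / 2) := by
    rw [← Real.exp_add]; ring_nf
  rw [Real.exp_neg, inv_mul_eq_div, le_div_iff₀ (Real.exp_pos _)]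
  rw [e] at h4
  have := Real.exp_pos (l * ε ^ 2 / 2)
  refine le_of_mul_le_mul_left ?_ this
  linarith

lemma km_hoeff2 {G : Type} [DecidableEq G] (B : Finset G) (f : G → ℝ) (hf : ∀ v ∈ B, |f v| ≤ 1)
    (h0 : ∑ v ∈ B, f v = 0) (l : ℕ) (ε : ℝ) (hε : 0 ≤ ε) :
    (((Fintype.piFinset fun _ : Fin l => B).filter (fun v => l * ε < |∑ i, f (v i)|)).card : ℝ)
      ≤ 2 * Real.exp (- (l * ε ^ 2 / 2)) * (B.card : ℝ) ^ l := by
  have h1 := km_hoeff B f hf h0 l ε hε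
  have h2 := km_hoeff B (fun x => - f x) (by simpa using hf) (by simpa using h0) l ε hε
  have h3 : (Fintype.piFinset fun _ : Fin l => B).filter (fun v => l * ε < |∑ i, f (v i)|) ⊆
    ((Fintype.piFinset fun _ : Fin l => B).filter (fun v => l * ε < ∑ i, f (v i))) ∪
    ((Fintype.piFinset fun _ : Fin l => B).filter (fun v => l * ε < ∑ i, - f (v i))) := by
    intro v hv
    simp only [Finset.mem_filter, Finset.mem_union, lt_abs, Finset.sum_neg_distrib] at hv ⊢
    tauto
  have h4 : (_ : ℝ) ≤ _ := Nat.cast_le.mpr ((Finset.card_le_card h3).trans (Finset.card_union_le _ _))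
  push_cast at h4
  linarith


/-- Almost periodicity. -/
lemma km_ap {G : Type} [AddCommGroup G] [Fintype G] [DecidableEq G] (B : Finset G)
    (hB : B.Nonempty) (w : G → ℝ) (hw0 : ∀ x, 0 ≤ w x) (hw1 : ∀ x, w x ≤ 1) (l : ℕ) (hl : 0 < l)
    (ε : ℝ) (hε : 0 < ε)
    (hlε : 4 * (Fintype.card G : ℝ) ≤ Real.exp (l * ε ^ 2 / 2) * (ε * B.card)) :
    ∃ X : Finset G, ((B.card : ℝ) / Fintype.card G) ^ l * Fintype.card G / 2 ≤ X.card ∧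
      ∀ t ∈ X, ∀ t' ∈ X, ∀ y,
        |∑ u ∈ B, ∑ v ∈ B, w (y + t - t' + (v - u)) - ∑ u ∈ B, ∑ v ∈ B, w (y + (v - u))|
          ≤ 4 * ε * (B.card : ℝ) ^ 2 := by
  classical
  have hN : (0 : ℝ) < Fintype.card G := by exact_mod_cast Fintype.card_pos
  have hb : (0 : ℝ) < B.card := by exact_mod_cast hB.card_pos
  have hl0 : (0 : ℝ) < l := by exact_mod_cast hl
  set N : ℝ := ((Fintype.card G : ℕ) : ℝ) with hNdef
  set b : ℝ := (B.card : ℝ) with hbdef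
  set h : G → ℝ := fun x => (∑ v ∈ B, w (x + v)) / b with hh
  have hh0 : ∀ x, 0 ≤ h x := fun x => div_nonneg (Finset.sum_nonneg fun _ _ => hw0 _) hb.le
  have hh1 : ∀ x, h x ≤ 1 := by
    intro x
    rw [hh, div_le_one hb]
    calc _ ≤ ∑ v ∈ B, (1:ℝ) := Finset.sum_le_sum fun _ _ => hw1 _
      _ = b := by simp [hbdef]
  -- deviation (unnormalised)
  set dev : (Fin l → G) → G → ℝ := fun v x => ∑ i, (w (x + v i) - h x) with hdev
  set P := Fintype.piFinset fun _ : Fin l => B with hP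
  have hPc : (P.card : ℝ) = b ^ l := by simp [hP, hbdef]
  have hbound : ∀ x, ((P.filter (fun v => l * ε < |dev v x|)).card : ℝ)
      ≤ 2 * Real.exp (- (l * ε ^ 2 / 2)) * b ^ l := by
    intro x
    refine km_hoeff2 B (fun v => w (x + v) - h x) ?_ ?_ l ε hε.le
    · intro v _
      rw [abs_le]
      constructor <;> linarith [hw0 (x + v), hw1 (x + v), hh0 x, hh1 x]
    · rw [Finset.sum_sub_distrib]
      simp only [Finset.sum_const, nsmul_eq_mul, hh, ← hbdef]
      field_simp; ring
  set bad : (Fin l → G) → Finset G := fun v => univ.filter (fun x => l * ε < |dev v x|) with hbad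
  set L := P.filter (fun v => ((bad v).card : ℝ) ≤ ε * b) with hL
  have hsumbad : ∑ v ∈ P, ((bad v).card : ℝ) ≤ N * (2 * Real.exp (- (l * ε ^ 2 / 2)) * b ^ l) := by
    have : ∑ v ∈ P, ((bad v).card : ℝ) = ∑ x, ((P.filter (fun v => l * ε < |dev v x|)).card : ℝ) := by
      simp only [hbad, Finset.card_filter]
      push_cast
      rw [Finset.sum_comm]
    rw [this]
    calc _ ≤ ∑ x : G, 2 * Real.exp (- (l * ε ^ 2 / 2)) * b ^ l := Finset.sum_le_sum fun x _ => hbound x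
      _ = _ := by simp [hNdef]
  have hLc : b ^ l / 2 ≤ L.card := by
    have h1 : ((P.filter (fun v => ¬ ((bad v).card : ℝ) ≤ ε * b)).card : ℝ) * (ε * b)
        ≤ ∑ v ∈ P, ((bad v).card : ℝ) := by
      calc _ = ∑ v ∈ P.filter (fun v => ¬ ((bad v).card : ℝ) ≤ ε * b), (ε * b) := by simp
        _ ≤ ∑ v ∈ P.filter (fun v => ¬ ((bad v).card : ℝ) ≤ ε * b), ((bad v).card : ℝ) :=
            Finset.sum_le_sum fun v hv => (not_le.mp (Finset.mem_filter.mp hv).2).le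
        _ ≤ _ := Finset.sum_le_sum_of_subset_of_nonneg (Finset.filter_subset _ _)
            fun _ _ _ => by positivity
    have h2 : (L.card : ℝ) + ((P.filter (fun v => ¬ ((bad v).card : ℝ) ≤ ε * b)).card : ℝ) = b ^ l := by
      rw [← hPc, ← Finset.card_filter_add_card_filter_not (s := P) (fun v => ((bad v).card : ℝ) ≤ ε * b)]
      push_cast; rfl
    have h3 : N * (2 * Real.exp (- (l * ε ^ 2 / 2)) * b ^ l) ≤ b ^ l / 2 * (ε * b) := by
      rw [Real.exp_neg]
      have he := Real.exp_pos (l * ε ^ 2 / 2)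
      have : N * (2 * (Real.exp (l * ε ^ 2 / 2))⁻¹ * b ^ l) =
        (4 * N) * (b ^ l / 2) * (Real.exp (l * ε ^ 2 / 2))⁻¹ := by ring
      rw [this, mul_inv_le_iff₀ he]
      calc _ ≤ (Real.exp (l * ε ^ 2 / 2) * (ε * b)) * (b ^ l / 2) := by gcongr
        _ = _ := by ring
    have h4 := le_of_mul_le_mul_right (h1.trans (hsumbad.trans h3)) (by positivity)
    linarith
  -- pigeonhole
  have hpig : ∃ c : Fin l → G, (b / N) ^ l * N / 2 ≤
      ((univ.filter (fun t : G => (fun i => c i - t) ∈ L)).card : ℝ) := by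
    by_contra hcon
    push Not at hcon
    have q := Finset.sum_lt_sum_of_nonempty (s := (univ : Finset (Fin l → G))) ⟨0, by simp⟩
      (fun s _ => hcon s)
    have e : ∑ c : Fin l → G, ((univ.filter (fun t : G => (fun i => c i - t) ∈ L)).card : ℝ)
        = N * L.card := by
      simp only [Finset.card_filter]
      push_cast
      rw [Finset.sum_comm]
      rw [hNdef, ← nsmul_eq_mul, ← Finset.card_univ, ← Finset.sum_const]
      refine Finset.sum_congr rfl fun t _ => ?_
      have : (L.card : ℝ) = ∑ c : Fin l → G, if c ∈ L then 1 else 0 := by simp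
      rw [this]
      exact Fintype.sum_equiv (Equiv.subRight (fun _ : Fin l => t)) _ _ (fun c => rfl)
    rw [e] at q
    simp only [Finset.sum_const, Finset.card_univ, nsmul_eq_mul, Fintype.card_pi_const] at q
    push_cast at q
    rw [← hNdef] at q
    have : N ^ l * ((b / N) ^ l * N / 2) = N * (b ^ l / 2) := by
      rw [div_pow]; field_simp
    rw [this] at q
    have := lt_of_mul_lt_mul_left q hN.le
    linarith
  obtain ⟨c, hc⟩ := hpig
  refine ⟨_, hc, ?_⟩
  set gc : G → ℝ := fun y => ∑ u ∈ B, (∑ i, w (y - u + c i)) / l with hgc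
  set g : G → ℝ := fun y => ∑ u ∈ B, h (y - u) with hg
  have key : ∀ t, (fun i => c i - t) ∈ L → ∀ y, |gc (y - t) - g y| ≤ 2 * ε * b := by
    intro t ht y
    have hbd := (Finset.mem_filter.mp ht).2
    set v : Fin l → G := fun i => c i - t with hv
    have e1 : gc (y - t) - g y = ∑ u ∈ B, dev v (y - u) / l := by
      simp only [hgc, hg, ← Finset.sum_sub_distrib]
      refine Finset.sum_congr rfl fun u _ => ?_
      simp only [hdev, Finset.sum_sub_distrib, Finset.sum_const, Finset.card_univ, Fintype.card_fin, nsmul_eq_mul]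
      have : ∀ i, y - u + v i = y - t - u + c i := by intro i; simp only [hv]; abel
      simp only [this]
      field_simp
    rw [e1]
    have hd1 : ∀ x, |dev v x / l| ≤ 1 := by
      intro x
      rw [abs_div, abs_of_pos hl0, div_le_one hl0]
      calc _ ≤ ∑ i, |w (x + v i) - h x| := Finset.abs_sum_le_sum_abs _ _
        _ ≤ ∑ i : Fin l, (1:ℝ) := by
            refine Finset.sum_le_sum fun i _ => ?_
            rw [abs_le]
            constructor <;> linarith [hw0 (x + v i), hw1 (x + v i), hh0 x, hh1 x]
        _ = l := by simp
    have hd2 : ∀ x, |dev v x / l| ≤ ε + (if x ∈ bad v then 1 else 0) := by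
      intro x
      split_ifs with hx
      · linarith [hd1 x]
      · simp only [hbad, Finset.mem_filter, Finset.mem_univ, true_and, not_lt] at hx
        rw [abs_div, abs_of_pos hl0, div_le_iff₀ hl0]
        linarith
    calc _ ≤ ∑ u ∈ B, |dev v (y - u) / l| := Finset.abs_sum_le_sum_abs _ _
      _ ≤ ∑ u ∈ B, (ε + (if y - u ∈ bad v then 1 else 0)) := Finset.sum_le_sum fun u _ => hd2 _
      _ = ε * b + ∑ u ∈ B, (if y - u ∈ bad v then 1 else 0) := by
          rw [Finset.sum_add_distrib]; simp [hbdef]; ring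
      _ ≤ ε * b + ∑ u, (if y - u ∈ bad v then 1 else 0) := by
          exact add_le_add le_rfl (Finset.sum_le_sum_of_subset_of_nonneg (Finset.subset_univ _)
            fun _ _ _ => by split_ifs <;> norm_num)
      _ = ε * b + (bad v).card := by
          congr 1
          rw [Fintype.sum_equiv (Equiv.subLeft y) (fun u => if y - u ∈ bad v then (1:ℝ) else 0)
            (fun u => if u ∈ bad v then (1:ℝ) else 0) (fun _ => rfl)]
          simp
      _ ≤ _ := by linarith
  have hgw : ∀ y, ∑ u ∈ B, ∑ v ∈ B, w (y + (v - u)) = b * g y := by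
    intro y
    simp only [hg, hh, Finset.mul_sum]
    refine Finset.sum_congr rfl fun u _ => ?_
    rw [mul_div_cancel₀ _ hb.ne']
    refine Finset.sum_congr rfl fun v _ => ?_
    congr 1; abel
  intro t ht t' ht' y
  simp only [Finset.mem_filter, Finset.mem_univ, true_and] at ht ht'
  rw [hgw, hgw, ← mul_sub, abs_mul, abs_of_pos hb]
  have k1 := key t ht (y + t - t')
  have k2 := key t' ht' y
  have : y + t - t' - t = y - t' := by abel
  rw [this] at k1
  have k3 : |g (y + t - t') - g y| ≤ 4 * ε * b := by
    rw [abs_le] at *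
    constructor <;> linarith
  nlinarith


lemma km_pi_surj {K V : Type} [Field K] [AddCommGroup V] [Module K V] {ι : Type} [Fintype ι]
    [DecidableEq ι] (φ : ι → Module.Dual K V) (h : LinearIndependent K φ) :
    ∀ y : ι → K, ∃ x : V, (fun i => φ i x) = y := by
  have hs : LinearMap.range (LinearMap.pi φ) = ⊤ := by
    by_contra hne
    obtain ⟨f, hf0, hf⟩ := Submodule.exists_le_ker_of_lt_top _ (lt_top_iff_ne_top.mpr hne)
    apply hf0
    have hfe : ∀ y : ι → K, f y = ∑ i, y i * f (Pi.single i 1) := by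
      intro y
      conv_lhs => rw [pi_eq_sum_univ' y]
      rw [map_sum]
      refine Finset.sum_congr rfl fun i _ => ?_
      rw [map_smul, smul_eq_mul]
    have h0 : ∑ i, f (Pi.single i 1) • φ i = 0 := by
      ext x
      have : f (LinearMap.pi φ x) = 0 := hf (LinearMap.mem_range_self _ x)
      rw [hfe] at this
      simp only [LinearMap.pi_apply] at this
      simp only [LinearMap.coe_sum, Finset.sum_apply, LinearMap.smul_apply, smul_eq_mul, LinearMap.zero_apply]
      rw [← this]
      exact Finset.sum_congr rfl fun i _ => mul_comm _ _
    have hc := Fintype.linearIndependent_iff.mp h _ h0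
    ext y
    simp [hc]
  intro y
  obtain ⟨x, hx⟩ := LinearMap.range_eq_top.mp hs y
  exact ⟨x, hx⟩

lemma km_pi_sum {q : ℕ} [Fact q.Prime] {G : Type} [AddCommGroup G] [Module (ZMod q) G] [Fintype G]
    {ι : Type} [Fintype ι] [DecidableEq ι] (φ : ι → Module.Dual (ZMod q) G)
    (h : LinearIndependent (ZMod q) φ) (r : ι → ZMod q → ℝ) :
    (q : ℝ) ^ Fintype.card ι * ∑ x, ∏ i, r i (φ i x) = Fintype.card G * ∏ i, ∑ z, r i z := by
  choose s hs using km_pi_surj φ h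
  have h1 : ∀ y : ι → ZMod q, ∑ x, ∏ i, r i (φ i x) = ∑ x, ∏ i, r i (φ i x + y i) := by
    intro y
    refine (Fintype.sum_equiv (Equiv.addRight (s y)) _ _ ?_).symm
    intro x
    refine Finset.prod_congr rfl fun i _ => ?_
    have := congrFun (hs y) i
    simp [← this]
  have h2 : ∑ y : ι → ZMod q, ∑ x, ∏ i, r i (φ i x) = (q : ℝ) ^ Fintype.card ι * ∑ x, ∏ i, r i (φ i x) := by
    simp [Finset.sum_const, ZMod.card]
  rw [← h2, Finset.sum_congr rfl (fun y _ => h1 y), Finset.sum_comm]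
  rw [← nsmul_eq_mul, ← Finset.card_univ, ← Finset.sum_const]
  refine Finset.sum_congr rfl fun x _ => ?_
  rw [Fintype.prod_sum]
  exact Fintype.sum_equiv (Equiv.addLeft (fun i => φ i x)) _ _ (fun y => rfl)

/-- unnormalised Fourier transform of a set -/
noncomputable def kmHat {q : ℕ} [Fact q.Prime] {G : Type} [AddCommGroup G] [Module (ZMod q) G]
    (X : Finset G) (φ : Module.Dual (ZMod q) G) : ℂ :=
  ∑ x ∈ X, (ZMod.stdAddChar (φ x) : ℂ)

lemma km_std_sum {q : ℕ} [Fact q.Prime] : ∑ z : ZMod q, (ZMod.stdAddChar z : ℂ) = 0 := by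
  classical
  rw [AddChar.sum_eq_ite, if_neg]
  intro h
  have := ZMod.isPrimitive_stdAddChar q (one_ne_zero)
  apply this
  ext z
  simp [h]

lemma km_chang {q : ℕ} [Fact q.Prime] {G : Type} [AddCommGroup G] [Module (ZMod q) G] [Fintype G]
    (X : Finset G) (hX : X.Nonempty) {ι : Type} [Fintype ι] [DecidableEq ι]
    (φ : ι → Module.Dual (ZMod q) G)
    (h : LinearIndependent (ZMod q) φ) (hφ : ∀ i, (X.card : ℝ) / 2 ≤ ‖kmHat X (φ i)‖) :
    (Fintype.card ι : ℝ) ≤ 8 * Real.log (Fintype.card G / X.card) := by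
  classical
  have hN : (0 : ℝ) < Fintype.card G := by exact_mod_cast Fintype.card_pos
  have hX0 : (0 : ℝ) < X.card := by exact_mod_cast hX.card_pos
  have hq : (0 : ℝ) < q := by exact_mod_cast (Fact.out : q.Prime).pos
  have hc : ∀ i, ∃ c : ℂ, ‖c‖ = 1 ∧ ‖kmHat X (φ i)‖ = c * kmHat X (φ i) :=
    fun i => Complex.exists_norm_eq_mul_self _
  choose c hc1 hc2 using hc
  set r : ι → ZMod q → ℝ := fun i z => (c i * ZMod.stdAddChar z).re with hr
  have hr1 : ∀ i z, |r i z| ≤ 1 := by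
    intro i z
    refine (Complex.abs_re_le_norm _).trans ?_
    rw [norm_mul, hc1, AddChar.norm_apply]; norm_num
  have hr0 : ∀ i, ∑ z, r i z = 0 := by
    intro i
    simp only [hr]
    rw [← Complex.re_sum, ← Finset.mul_sum, km_std_sum]; simp
  have hrX : ∀ i, (X.card : ℝ) / 2 ≤ ∑ x ∈ X, r i (φ i x) := by
    intro i
    refine (hφ i).trans (le_of_eq ?_)
    simp only [hr]
    rw [← Complex.re_sum, ← Finset.mul_sum]
    have := congrArg Complex.re (hc2 i)
    rw [Complex.ofReal_re] at this
    exact this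
  set d : ℝ := (Fintype.card ι : ℝ) with hd
  set R : G → ℝ := fun x => ∑ i, r i (φ i x) with hR
  have hRX : d * (X.card / 2) ≤ ∑ x ∈ X, R x := by
    simp only [hR]
    rw [Finset.sum_comm]
    calc _ = ∑ i : ι, (X.card : ℝ) / 2 := by simp [hd]
      _ ≤ _ := Finset.sum_le_sum fun i _ => hrX i
  have low : (X.card : ℝ) * Real.exp (d / 4) ≤ ∑ x ∈ X, Real.exp (1 / 2 * R x) := by
    calc (X.card : ℝ) * Real.exp (d / 4) ≤ ∑ x ∈ X, Real.exp (d / 4) * (1 + (1 / 2 * R x - d / 4)) := by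
          rw [← Finset.mul_sum, Finset.sum_add_distrib, Finset.sum_sub_distrib, ← Finset.mul_sum]
          simp only [Finset.sum_const, nsmul_eq_mul]
          have := Real.exp_pos (d / 4)
          rw [mul_comm]
          gcongr
          linarith
      _ ≤ _ := by
          refine Finset.sum_le_sum fun x _ => ?_
          have : Real.exp (1 / 2 * R x) = Real.exp (d / 4) * Real.exp (1 / 2 * R x - d / 4) := by
            rw [← Real.exp_add]; ring_nf
          rw [this]
          gcongr
          linarith [Real.add_one_le_exp (1 / 2 * R x - d / 4)]
  have up : ∑ x ∈ X, Real.exp (1 / 2 * R x) ≤ Fintype.card G * Real.exp (d / 8) := by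
    calc _ ≤ ∑ x, Real.exp (1 / 2 * R x) :=
          Finset.sum_le_sum_of_subset_of_nonneg (Finset.subset_univ _) fun _ _ _ => (Real.exp_pos _).le
      _ ≤ ∑ x, ∏ i, (Real.cosh (1 / 2) + r i (φ i x) * Real.sinh (1 / 2)) := by
          refine Finset.sum_le_sum fun x _ => ?_
          simp only [hR]
          rw [Finset.mul_sum, Real.exp_sum]
          exact Finset.prod_le_prod (fun _ _ => (Real.exp_pos _).le)
            fun i _ => km_exp_conv _ _ (hr1 _ _)
      _ = Fintype.card G * Real.cosh (1 / 2) ^ Fintype.card ι := by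
          have := km_pi_sum φ h (fun i z => Real.cosh (1 / 2) + r i z * Real.sinh (1 / 2))
          simp only [Finset.sum_add_distrib, ← Finset.sum_mul, hr0, Finset.sum_const,
            Finset.card_univ, ZMod.card, nsmul_eq_mul, Finset.prod_const, zero_mul, add_zero] at this
          rw [mul_pow] at this
          have hqd : (0:ℝ) < (q:ℝ) ^ Fintype.card ι := by positivity
          refine mul_left_cancel₀ hqd.ne' ?_
          rw [this]; ring
      _ ≤ Fintype.card G * Real.exp (d / 8) := by
          gcongr
          calc _ ≤ Real.exp ((1 / 2) ^ 2 / 2) ^ Fintype.card ι :=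
                pow_le_pow_left₀ (Real.cosh_pos _).le (Real.cosh_le_exp_half_sq _) _
            _ = _ := by rw [← Real.exp_nat_mul]; congr 1; rw [hd]; ring
  have h3 := low.trans up
  have e : Real.exp (d / 4) = Real.exp (d / 8) * Real.exp (d / 8) := by
    rw [← Real.exp_add]; ring_nf
  rw [e] at h3
  have hp := Real.exp_pos (d / 8)
  have h4 : Real.exp (d / 8) ≤ Fintype.card G / X.card := by
    rw [le_div_iff₀ hX0]
    refine le_of_mul_le_mul_left ?_ hp
    linarith
  have := (Real.le_log_iff_exp_le (by positivity)).mpr h4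
  linarith

lemma km_span {q : ℕ} [Fact q.Prime] {G : Type} [AddCommGroup G] [Module (ZMod q) G] [Fintype G]
    (X : Finset G) (hX : X.Nonempty) :
    ((Module.finrank (ZMod q) G : ℝ) - Module.finrank (ZMod q)
      (Submodule.span (ZMod q) {φ : Module.Dual (ZMod q) G |
        (X.card : ℝ) / 2 ≤ ‖kmHat X φ‖}).dualCoannihilator)
      ≤ 8 * Real.log (Fintype.card G / X.card) := by
  classical
  set Γ := {φ : Module.Dual (ZMod q) G | (X.card : ℝ) / 2 ≤ ‖kmHat X φ‖} with hΓ
  have : Finite (Module.Dual (ZMod q) G) := Module.finite_of_finite (ZMod q)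
  obtain ⟨b, hb, hs, hli⟩ := exists_linearIndependent (ZMod q) Γ
  have : Fintype b := Fintype.ofFinite _
  have h1 := km_chang X hX (fun i : b => (i : Module.Dual (ZMod q) G)) hli (fun i => hb i.2)
  have h2 := Subspace.finrank_add_finrank_dualCoannihilator_eq (Submodule.span (ZMod q) Γ)
  have h3 : Module.finrank (ZMod q) (Submodule.span (ZMod q) Γ) = Fintype.card b := by
    rw [← hs, finrank_span_set_eq_card hli, Set.toFinset_card]
  rw [h3] at h2
  have : (Module.finrank (ZMod q) G : ℝ) = Fintype.card b + Module.finrank (ZMod q)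
    (Submodule.span (ZMod q) Γ).dualCoannihilator := by exact_mod_cast h2.symm
  linarith


noncomputable def kmT {G : Type} [AddCommGroup G] (X : Finset G) (f : G → ℝ) (y : G) : ℝ :=
  ∑ t ∈ X, ∑ t' ∈ X, f (y + t - t')

lemma km_card_dual {q : ℕ} [Fact q.Prime] {G : Type} [AddCommGroup G] [Module (ZMod q) G] [Fintype G]
    [Fintype (Module.Dual (ZMod q) G)] :
    Fintype.card (Module.Dual (ZMod q) G) = Fintype.card G := by
  rw [Module.card_eq_pow_finrank (K := ZMod q) (V := G),
    Module.card_eq_pow_finrank (K := ZMod q) (V := Module.Dual (ZMod q) G), Subspace.dual_finrank_eq]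

lemma km_std_ne {q : ℕ} [Fact q.Prime] (z : ZMod q) (hz : z ≠ 0) :
    ∃ a : ZMod q, (ZMod.stdAddChar (a * z) : ℂ) ≠ 1 := by
  by_contra hcon
  push Not at hcon
  refine ZMod.isPrimitive_stdAddChar q hz ?_
  ext a
  simpa [mul_comm] using hcon a

lemma km_orth {q : ℕ} [Fact q.Prime] {G : Type} [AddCommGroup G] [Module (ZMod q) G] [Fintype G]
    [DecidableEq G] [Fintype (Module.Dual (ZMod q) G)] (x : G) :
    ∑ φ : Module.Dual (ZMod q) G, (ZMod.stdAddChar (φ x) : ℂ)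
      = if x = 0 then (Fintype.card G : ℂ) else 0 := by
  classical
  split_ifs with hx
  · subst hx
    simp [km_card_dual]
  · set ψ : AddChar (Module.Dual (ZMod q) G) ℂ := (ZMod.stdAddChar (N := q)).compAddMonoidHom
      (Module.Dual.eval (ZMod q) G x).toAddMonoidHom with hψ
    have h1 : ∀ φ, (ZMod.stdAddChar (φ x) : ℂ) = ψ φ := fun φ => rfl
    simp_rw [h1]
    rw [AddChar.sum_eq_ite, if_neg]
    intro h
    have h2 : ∃ φ : Module.Dual (ZMod q) G, φ x ≠ 0 := by
      by_contra hcon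
      push Not at hcon
      exact hx ((Module.forall_dual_apply_eq_zero_iff (ZMod q) x).mp hcon)
    obtain ⟨φ, hφ⟩ := h2
    obtain ⟨a, ha⟩ := km_std_ne (φ x) hφ
    apply ha
    have : ψ (a • φ) = 1 := by rw [h]; rfl
    rw [← h1] at this
    simpa using this

lemma km_hat_sq {q : ℕ} [Fact q.Prime] {G : Type} [AddCommGroup G] [Module (ZMod q) G]
    (X : Finset G) (φ : Module.Dual (ZMod q) G) :
    ((‖kmHat X φ‖ ^ 2 : ℝ) : ℂ) = ∑ t ∈ X, ∑ t' ∈ X, (ZMod.stdAddChar (φ (t - t')) : ℂ) := by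
  push_cast
  rw [← Complex.mul_conj', kmHat, map_sum, Finset.sum_mul_sum]
  refine Finset.sum_congr rfl fun t _ => Finset.sum_congr rfl fun t' _ => ?_
  rw [← AddChar.map_neg_eq_conj, ← AddChar.map_add_eq_mul, map_sub, sub_eq_add_neg]

lemma km_T_four {q : ℕ} [Fact q.Prime] {G : Type} [AddCommGroup G] [Module (ZMod q) G]
    [Fintype (Module.Dual (ZMod q) G)] (X : Finset G) (f : G → ℝ) (c : Module.Dual (ZMod q) G → ℝ)
    (h : ∀ y, (f y : ℂ) = ∑ φ, (c φ : ℂ) * ZMod.stdAddChar (φ y)) (y : G) :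
    (kmT X f y : ℂ) = ∑ φ, ((c φ * ‖kmHat X φ‖ ^ 2 : ℝ) : ℂ) * ZMod.stdAddChar (φ y) := by
  unfold kmT
  push_cast
  simp_rw [h]
  have : ∀ φ : Module.Dual (ZMod q) G, (c φ : ℂ) * (‖kmHat X φ‖ : ℂ) ^ 2 * ZMod.stdAddChar (φ y)
      = ∑ t ∈ X, ∑ t' ∈ X, (c φ : ℂ) * ZMod.stdAddChar (φ (y + t - t')) := by
    intro φ
    have := km_hat_sq X φ
    push_cast at this
    rw [this, Finset.mul_sum, Finset.sum_mul]
    refine Finset.sum_congr rfl fun t _ => ?_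
    rw [Finset.mul_sum, Finset.sum_mul]
    refine Finset.sum_congr rfl fun t' _ => ?_
    rw [mul_assoc, ← AddChar.map_add_eq_mul, ← map_add]
    congr 3; abel
  simp_rw [this]
  symm
  rw [Finset.sum_comm]
  refine Finset.sum_congr rfl fun t _ => ?_
  rw [Finset.sum_comm]

lemma km_T_iter_four {q : ℕ} [Fact q.Prime] {G : Type} [AddCommGroup G] [Module (ZMod q) G]
    [Fintype (Module.Dual (ZMod q) G)] (X : Finset G) (f : G → ℝ) (c : Module.Dual (ZMod q) G → ℝ)
    (h : ∀ y, (f y : ℂ) = ∑ φ, (c φ : ℂ) * ZMod.stdAddChar (φ y)) (k : ℕ) : ∀ (y : G),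
    ((kmT X)^[k] f y : ℂ) = ∑ φ, ((c φ * (‖kmHat X φ‖ ^ 2) ^ k : ℝ) : ℂ) * ZMod.stdAddChar (φ y) := by
  induction k with
  | zero => simpa using h
  | succ k ih =>
    intro y
    rw [Function.iterate_succ_apply', km_T_four X _ _ ih]
    refine Finset.sum_congr rfl fun φ _ => ?_
    rw [pow_succ _ k, mul_assoc (c φ)]

lemma km_D_four {q : ℕ} [Fact q.Prime] {G : Type} [AddCommGroup G] [Module (ZMod q) G] [Fintype G]
    [Fintype (Module.Dual (ZMod q) G)] (A : Finset G) (y : G) :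
    (kmD A y : ℂ) = ∑ φ : Module.Dual (ZMod q) G,
      ((1 / Fintype.card G * ‖kmHat A φ‖ ^ 2 : ℝ) : ℂ) * ZMod.stdAddChar (φ y) := by
  classical
  have hN : (Fintype.card G : ℂ) ≠ 0 := by exact_mod_cast Fintype.card_pos.ne'
  rw [← km_T_four A (fun y => if y = 0 then 1 else 0) (fun _ => 1 / Fintype.card G)]
  · congr 1
    unfold kmT kmD
    rw [kmInd_sum]
    refine Finset.sum_congr rfl fun t _ => ?_
    have : ∀ t', (y + t - t' = 0) ↔ (y + t = t') := fun t' => sub_eq_zero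
    simp only [this, Finset.sum_ite_eq, kmInd]
  · intro y
    rw [← Finset.mul_sum, km_orth]
    push_cast
    split_ifs
    · push_cast; field_simp
    · simp

lemma km_four_step {q : ℕ} [Fact q.Prime] {G : Type} [AddCommGroup G] [Module (ZMod q) G] [Fintype G]
    [DecidableEq G] (A B X : Finset G) (hA : A.Nonempty) (hB : B.Nonempty) (hX : X.Nonempty) (k : ℕ)
    (hk : 16 * (Fintype.card G : ℝ) ≤ 4 ^ k * A.card)
    (h : (9 / 8) * ((A.card : ℝ) ^ 2 / Fintype.card G) * (B.card : ℝ) ^ 2 * ((X.card : ℝ) ^ 2) ^ k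
      ≤ (kmT X)^[k] (kmT B (kmD A)) 0)
    (W : Submodule (ZMod q) G) [Fintype W]
    (hW : W = (Submodule.span (ZMod q) {φ : Module.Dual (ZMod q) G |
        (X.card : ℝ) / 2 ≤ ‖kmHat X φ‖}).dualCoannihilator) :
    ∃ a ∈ A, (17 / 16) * ((A.card : ℝ) / Fintype.card G) * Fintype.card W ≤
      ((univ.filter (fun x : W => a + (x : G) ∈ A)).card : ℝ) := by
  classical
  have : Finite (Module.Dual (ZMod q) G) := Module.finite_of_finite (ZMod q)
  have : Fintype (Module.Dual (ZMod q) G) := Fintype.ofFinite _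
  have hN : (0 : ℝ) < Fintype.card G := by exact_mod_cast Fintype.card_pos
  have hA0 : (0 : ℝ) < A.card := by exact_mod_cast hA.card_pos
  have hB0 : (0 : ℝ) < B.card := by exact_mod_cast hB.card_pos
  have hX0 : (0 : ℝ) < X.card := by exact_mod_cast hX.card_pos
  set N : ℝ := ((Fintype.card G : ℕ) : ℝ) with hNdef
  have hnorm : ∀ (Y : Finset G) (φ : Module.Dual (ZMod q) G), ‖kmHat Y φ‖ ≤ Y.card := by
    intro Y φ
    refine (norm_sum_le _ _).trans ?_
    simp
  -- Fourier expansion at zero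
  have e1 : N * (kmT X)^[k] (kmT B (kmD A)) 0 =
      ∑ φ : Module.Dual (ZMod q) G, ‖kmHat A φ‖ ^ 2 * ‖kmHat B φ‖ ^ 2 * (‖kmHat X φ‖ ^ 2) ^ k := by
    have := km_T_iter_four X _ _ (km_T_four B _ _ (km_D_four (q := q) A)) k 0
    simp only [map_zero, AddChar.map_zero_eq_one, mul_one] at this
    rw [← Complex.ofReal_sum] at this
    rw [Complex.ofReal_injective this, Finset.mul_sum]
    refine Finset.sum_congr rfl fun φ _ => ?_
    rw [← hNdef]; field_simp
  have e2 : N * A.card = ∑ φ : Module.Dual (ZMod q) G, ‖kmHat A φ‖ ^ 2 := by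
    have := km_D_four (q := q) A 0
    simp only [map_zero, AddChar.map_zero_eq_one, mul_one] at this
    rw [← Complex.ofReal_sum] at this
    have h0 : kmD A 0 = A.card := by
      unfold kmD; rw [kmInd_sum]; simp [kmInd]
    have := Complex.ofReal_injective this
    rw [h0] at this
    rw [this, Finset.mul_sum]
    refine Finset.sum_congr rfl fun φ _ => ?_
    rw [← hNdef]; field_simp
  set Γ : Finset (Module.Dual (ZMod q) G) := univ.filter fun φ => (X.card : ℝ) / 2 ≤ ‖kmHat X φ‖ with hΓ
  have h4k : (0:ℝ) < 4 ^ k := by positivity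
  have e3 : ∀ φ : Module.Dual (ZMod q) G, ‖kmHat A φ‖ ^ 2 * ‖kmHat B φ‖ ^ 2 * (‖kmHat X φ‖ ^ 2) ^ k
      ≤ ((B.card : ℝ) ^ 2 * ((X.card : ℝ) ^ 2) ^ k) *
        ((if φ ∈ Γ then ‖kmHat A φ‖ ^ 2 else 0) + ‖kmHat A φ‖ ^ 2 / 4 ^ k) := by
    intro φ
    have b1 : ‖kmHat B φ‖ ^ 2 ≤ (B.card : ℝ) ^ 2 := pow_le_pow_left₀ (norm_nonneg _) (hnorm B φ) 2
    split_ifs with hφ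
    · have b2 : (‖kmHat X φ‖ ^ 2) ^ k ≤ ((X.card : ℝ) ^ 2) ^ k := by
        gcongr; exact hnorm X φ
      calc _ ≤ ‖kmHat A φ‖ ^ 2 * (B.card : ℝ) ^ 2 * ((X.card : ℝ) ^ 2) ^ k := by gcongr
        _ = ((B.card : ℝ) ^ 2 * ((X.card : ℝ) ^ 2) ^ k) * (‖kmHat A φ‖ ^ 2 + 0) := by ring
        _ ≤ _ := by gcongr; positivity
    · have hφ' : ‖kmHat X φ‖ ≤ X.card / 2 := by
        simp only [hΓ, Finset.mem_filter, Finset.mem_univ, true_and, not_le] at hφ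
        exact hφ.le
      have b2 : (‖kmHat X φ‖ ^ 2) ^ k ≤ ((X.card : ℝ) ^ 2) ^ k / 4 ^ k := by
        rw [← div_pow]
        have : (X.card : ℝ) ^ 2 / 4 = (X.card / 2) ^ 2 := by ring
        rw [this]
        gcongr
      calc _ ≤ ‖kmHat A φ‖ ^ 2 * (B.card : ℝ) ^ 2 * (((X.card : ℝ) ^ 2) ^ k / 4 ^ k) := by gcongr
        _ = _ := by ring
  have e4 := Finset.sum_le_sum fun φ (_ : φ ∈ univ) => e3 φ
  rw [← e1, ← Finset.mul_sum, Finset.sum_add_distrib, ← Finset.sum_div, ← e2] at e4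
  set S₀ := ∑ φ : Module.Dual (ZMod q) G, (if φ ∈ Γ then ‖kmHat A φ‖ ^ 2 else 0) with hS₀
  set M := (B.card : ℝ) ^ 2 * ((X.card : ℝ) ^ 2) ^ k with hM
  have hM0 : 0 < M := by positivity
  have e5 : (17 / 16) * (A.card : ℝ) ^ 2 ≤ S₀ := by
    have : M * ((9 / 8) * (A.card : ℝ) ^ 2) ≤ M * (S₀ + N * A.card / 4 ^ k) := by
      refine le_trans ?_ e4
      have := mul_le_mul_of_nonneg_left h hN.le
      refine le_trans (le_of_eq ?_) this
      rw [hM]; field_simp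
    have := le_of_mul_le_mul_left this hM0
    have t : N * A.card / 4 ^ k ≤ (A.card : ℝ) ^ 2 / 16 := by
      rw [div_le_div_iff₀ h4k (by norm_num)]
      nlinarith
    linarith
  -- subgroup sum
  have e6 : ∀ φ : Module.Dual (ZMod q) G, ∃ r : ℝ, (∑ x : W, (ZMod.stdAddChar (φ x) : ℂ)) = (r : ℂ) ∧ 0 ≤ r ∧
      (φ ∈ Γ → r = Fintype.card W) := by
    intro φ
    set ψ : AddChar W ℂ := (ZMod.stdAddChar (N := q)).compAddMonoidHom
      (φ.toAddMonoidHom.comp W.subtype.toAddMonoidHom) with hψ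
    have h1 : ∀ x : W, (ZMod.stdAddChar (φ x) : ℂ) = ψ x := fun x => rfl
    by_cases hφ : φ ∈ Γ
    · refine ⟨Fintype.card W, ?_, by positivity, fun _ => rfl⟩
      have : ∀ x : W, φ x = 0 := by
        intro x
        have hx := hW.le x.2
        rw [Submodule.mem_dualCoannihilator] at hx
        refine hx φ (Submodule.subset_span ?_)
        simpa [hΓ] using hφ
      simp [this]
    · simp_rw [h1]
      rw [AddChar.sum_eq_ite]
      split_ifs
      · exact ⟨Fintype.card W, by simp, by positivity, fun h => absurd h hφ⟩
      · exact ⟨0, by simp, le_rfl, fun h => absurd h hφ⟩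
  choose r hr1 hr2 hr3 using e6
  have e7 : N * ∑ x : W, kmD A x = ∑ φ : Module.Dual (ZMod q) G, ‖kmHat A φ‖ ^ 2 * r φ := by
    apply Complex.ofReal_injective
    push_cast
    simp_rw [km_D_four (q := q) A]
    rw [Finset.sum_comm, Finset.mul_sum]
    refine Finset.sum_congr rfl fun φ _ => ?_
    rw [← Finset.mul_sum, hr1]
    push_cast
    have : (N : ℂ) ≠ 0 := by exact_mod_cast hN.ne'
    rw [hNdef] at this ⊢
    push_cast at this ⊢
    field_simp
  have e8 : Fintype.card W * S₀ ≤ N * ∑ x : W, kmD A x := by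
    rw [e7, hS₀, Finset.mul_sum]
    refine Finset.sum_le_sum fun φ _ => ?_
    split_ifs with hφ
    · rw [hr3 φ hφ, mul_comm]
    · have := hr2 φ
      rw [mul_zero]; positivity
  have e9 : ∑ x : W, kmD A x = ∑ a ∈ A, ((univ.filter (fun x : W => a + (x : G) ∈ A)).card : ℝ) := by
    unfold kmD
    simp_rw [kmInd_sum]
    rw [Finset.sum_comm]
    refine Finset.sum_congr rfl fun a _ => ?_
    rw [Finset.card_filter]
    push_cast
    refine Finset.sum_congr rfl fun x _ => ?_
    simp only [kmInd, add_comm]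
  by_contra hcon
  push Not at hcon
  have := Finset.sum_lt_sum_of_nonempty hA hcon
  rw [← e9] at this
  simp only [Finset.sum_const, nsmul_eq_mul] at this
  have h5 := mul_lt_mul_of_pos_left this hN
  have h6 : N * (A.card * ((17 / 16) * ((A.card : ℝ) / N) * Fintype.card W)) =
    Fintype.card W * ((17 / 16) * (A.card : ℝ) ^ 2) := by field_simp
  rw [h6] at h5
  have h7 : (Fintype.card W : ℝ) * ((17 / 16) * (A.card : ℝ) ^ 2) ≤ Fintype.card W * S₀ := by gcongr
  linarith


lemma km_T_mono {G : Type} [AddCommGroup G] (X : Finset G) (f f' : G → ℝ) (h : ∀ y, f y ≤ f' y)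
    (k : ℕ) : ∀ y, (kmT X)^[k] f y ≤ (kmT X)^[k] f' y := by
  induction k with
  | zero => simpa using h
  | succ k ih =>
    intro y
    rw [Function.iterate_succ_apply', Function.iterate_succ_apply']
    exact Finset.sum_le_sum fun t _ => Finset.sum_le_sum fun t' _ => ih _

lemma km_T_low {G : Type} [AddCommGroup G] (X : Finset G) (f : G → ℝ) (η : ℝ)
    (h : ∀ t ∈ X, ∀ t' ∈ X, ∀ y, f y - η ≤ f (y + t - t')) (k : ℕ) :
    ∀ y, (f y - k * η) * ((X.card : ℝ) ^ 2) ^ k ≤ (kmT X)^[k] f y := by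
  induction k with
  | zero => simp
  | succ k ih =>
    intro y
    rw [Function.iterate_succ_apply']
    calc _ = ∑ t ∈ X, ∑ t' ∈ X, (f y - η - k * η) * ((X.card : ℝ) ^ 2) ^ k := by
          simp only [Finset.sum_const, nsmul_eq_mul]
          push_cast; ring
      _ ≤ ∑ t ∈ X, ∑ t' ∈ X, (f (y + t - t') - k * η) * ((X.card : ℝ) ^ 2) ^ k := by
          refine Finset.sum_le_sum fun t ht => Finset.sum_le_sum fun t' ht' => ?_
          have := h t ht t' ht' y
          gcongr
      _ ≤ _ := Finset.sum_le_sum fun t _ => Finset.sum_le_sum fun t' _ => ih _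

lemma km_step {q : ℕ} [Fact q.Prime] {G : Type} [AddCommGroup G] [Module (ZMod q) G] [Fintype G]
    (A C : Finset G) (hA : A.Nonempty) (γ : ℝ)
    (hC : ∀ x ∈ C, ∀ a ∈ A, ∀ b ∈ A, a + b ≠ x)
    (hCγ : γ * Fintype.card G ≤ C.card)
    (m k l : ℕ) (hm : Even m) (hm24 : 24 ≤ m) (hmγ : (3 / 2 : ℝ) ^ m ≤ γ * 2 ^ m)
    (α : ℝ) (hα0 : 0 < α) (hα : α ≤ (A.card : ℝ) / Fintype.card G)
    (hk0 : 0 < k) (hk : 16 ≤ 4 ^ k * α) (hl0 : 0 < l)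
    (hl : 4 ≤ Real.exp (l * (1 / (80 * k)) ^ 2 / 2) * (1 / (80 * k) * α ^ m)) :
    ∃ (W : Submodule (ZMod q) G) (a : G),
      (Module.finrank (ZMod q) G : ℝ) - Module.finrank (ZMod q) W ≤ 8 * Real.log (2 / (α ^ m) ^ l) ∧
      (17 / 16) * ((A.card : ℝ) / Fintype.card G) * Nat.card W ≤ Nat.card {x : W // a + (x : G) ∈ A} := by
  classical
  have hN : (0 : ℝ) < Fintype.card G := by exact_mod_cast Fintype.card_pos
  have hA0 : (0 : ℝ) < A.card := by exact_mod_cast hA.card_pos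
  set N : ℝ := ((Fintype.card G : ℕ) : ℝ) with hNdef
  set κ : ℝ := (A.card : ℝ) ^ 2 / N with hκ
  have hκ0 : 0 < κ := by positivity
  have h1 := km_lift A C m hm hC
  have h2 : N * ((3 / 2) * κ) ^ m ≤ ∑ x, kmD A x ^ m := by
    refine le_trans ?_ h1
    rw [mul_pow, mul_pow]
    calc N * ((3 / 2) ^ m * κ ^ m) ≤ N * ((γ * 2 ^ m) * κ ^ m) := by gcongr
      _ = (γ * N) * (2 ^ m * κ ^ m) := by ring
      _ ≤ C.card * (2 ^ m * κ ^ m) := by gcongr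
  obtain ⟨B, hB, hBc, hBs⟩ := km_sift A hA m hm24 h2
  have hB0 : (0 : ℝ) < B.card := by exact_mod_cast hB.card_pos
  rw [← hNdef] at hBc
  set w : G → ℝ := fun x => if (5 / 4) * κ ≤ kmD A x then (1:ℝ) else 0 with hw
  set ε : ℝ := 1 / (80 * k) with hε
  have hk0' : (0:ℝ) < k := by exact_mod_cast hk0
  have hε0 : 0 < ε := by positivity
  have hαm : α ^ m * N ≤ B.card := le_trans (by gcongr) hBc
  obtain ⟨X, hXc, hX⟩ := km_ap B hB w (fun x => by simp only [hw]; split_ifs <;> norm_num)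
    (fun x => by simp only [hw]; split_ifs <;> norm_num) l hl0 ε hε0 (by
      rw [← hNdef]
      calc 4 * N ≤ (Real.exp (l * ε ^ 2 / 2) * (ε * α ^ m)) * N := by gcongr
        _ = Real.exp (l * ε ^ 2 / 2) * (ε * (α ^ m * N)) := by ring
        _ ≤ _ := by gcongr)
  rw [← hNdef] at hXc
  have hXpos : (0:ℝ) < X.card := lt_of_lt_of_le (by positivity) hXc
  have hXne : X.Nonempty := by
    rw [← Finset.card_pos]; exact_mod_cast hXpos
  set W := (Submodule.span (ZMod q) {φ : Module.Dual (ZMod q) G |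
        (X.card : ℝ) / 2 ≤ ‖kmHat X φ‖}).dualCoannihilator with hW
  have hcod := km_span (q := q) X hXne
  rw [← hW, ← hNdef] at hcod
  set b : ℝ := (B.card : ℝ) with hb
  have hTB : ∀ y, kmT B w y = ∑ u ∈ B, ∑ v ∈ B, w (y + (v - u)) := by
    intro y
    unfold kmT
    rw [Finset.sum_comm]
    refine Finset.sum_congr rfl fun u _ => Finset.sum_congr rfl fun v _ => ?_
    congr 1; abel
  set f : G → ℝ := fun y => (5 / 4) * κ * kmT B w y with hf
  have hlow : (9 / 8) * κ * b ^ 2 * ((X.card : ℝ) ^ 2) ^ k ≤ (kmT X)^[k] (kmT B (kmD A)) 0 := by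
    refine le_trans ?_ (km_T_mono X f _ ?_ k 0)
    · refine le_trans ?_ (km_T_low X f ((5 / 4) * κ * (4 * ε * b ^ 2)) ?_ k 0)
      · gcongr
        have : (19 / 20) * b ^ 2 ≤ kmT B w 0 := by
          rw [hTB]; simp only [zero_add]; exact hBs
        have hke : k * ε = 1 / 80 := by rw [hε]; field_simp
        have e : k * ((5 / 4) * κ * (4 * ε * b ^ 2)) = (5 / 4) * κ * (4 * (k * ε) * b ^ 2) := by ring
        rw [e, hke]
        simp only [hf]
        have := mul_le_mul_of_nonneg_left this (show 0 ≤ (5 / 4) * κ by positivity)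
        nlinarith
      · intro t ht t' ht' y
        have := hX t ht t' ht' y
        rw [← hTB, ← hTB, abs_le] at this
        simp only [hf]
        have := mul_le_mul_of_nonneg_left this.1 (show 0 ≤ (5 / 4) * κ by positivity)
        linarith
    · intro y
      simp only [hf, kmT, Finset.mul_sum]
      refine Finset.sum_le_sum fun u _ => Finset.sum_le_sum fun v _ => ?_
      simp only [hw]
      split_ifs with hx
      · linarith
      · simpa using kmD_nonneg A _
  have hkk : 16 * N ≤ 4 ^ k * A.card := by
    have : α * N ≤ A.card := by rwa [← le_div_iff₀ hN]
    calc 16 * N ≤ (4 ^ k * α) * N := by gcongr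
      _ = 4 ^ k * (α * N) := by ring
      _ ≤ _ := by gcongr
  obtain ⟨a, ha, haW⟩ := km_four_step (q := q) A B X hA hB hXne k hkk hlow W hW
  refine ⟨W, a, ?_, ?_⟩
  · refine hcod.trans ?_
    refine mul_le_mul_of_nonneg_left (Real.log_le_log (by positivity) ?_) (by norm_num)
    have hβ : α ^ m ≤ b / N := by rwa [le_div_iff₀ hN]
    calc N / X.card ≤ N / ((b / N) ^ l * N / 2) := by gcongr
      _ = 2 / (b / N) ^ l := by field_simp
      _ ≤ _ := by gcongr
  · have e : Nat.card {x : W // a + (x : G) ∈ A} = (univ.filter (fun x : W => a + (x : G) ∈ A)).card := by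
      rw [Nat.card_eq_fintype_card, Fintype.card_subtype]
    rw [e, Nat.card_eq_fintype_card (α := W)]
    exact haW


lemma km_iter (q : ℕ) [Fact q.Prime] (α γ K : ℝ) (hK : 0 ≤ K)
    (hstep : ∀ (G : Type) [AddCommGroup G] [Module (ZMod q) G] [Fintype G] (A C : Finset G),
      A.Nonempty → (∀ x ∈ C, ∀ a ∈ A, ∀ b ∈ A, a + b ≠ x) → γ * Fintype.card G ≤ C.card →
      α ≤ (A.card : ℝ) / Fintype.card G →
      ∃ (W : Submodule (ZMod q) G) (a : G),
      (Module.finrank (ZMod q) G : ℝ) - Module.finrank (ZMod q) W ≤ K ∧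
      (17 / 16) * ((A.card : ℝ) / Fintype.card G) * Nat.card W ≤ Nat.card {x : W // a + (x : G) ∈ A})
    (n : ℕ) : ∀ (G : Type) [AddCommGroup G] [Module (ZMod q) G] [Fintype G] (A : Finset G),
      A.Nonempty → α ≤ (A.card : ℝ) / Fintype.card G →
      1 < (17 / 16 : ℝ) ^ n * ((A.card : ℝ) / Fintype.card G) →
      ∃ (W : Submodule (ZMod q) G) (v : G),
        (Module.finrank (ZMod q) G : ℝ) - Module.finrank (ZMod q) W ≤ n * K ∧
        (Nat.card {x : W // ∀ a ∈ A, ∀ b ∈ A, a + b ≠ v + (x : G)} : ℝ) ≤ γ * Nat.card W := by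
  classical
  induction n with
  | zero =>
    intro G _ _ _ A hA hα h1
    exfalso
    have hN : (0 : ℝ) < Fintype.card G := by exact_mod_cast Fintype.card_pos
    have : (A.card : ℝ) / Fintype.card G ≤ 1 := by
      rw [div_le_one hN]; exact_mod_cast Finset.card_le_univ A
    simp only [pow_zero, one_mul] at h1
    linarith
  | succ n ih =>
    intro G _ _ _ A hA hα h1
    have hN : (0 : ℝ) < Fintype.card G := by exact_mod_cast Fintype.card_pos
    have hA0 : (0 : ℝ) < A.card := by exact_mod_cast hA.card_pos
    set C : Finset G := univ.filter (fun x => ∀ a ∈ A, ∀ b ∈ A, a + b ≠ x) with hC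
    by_cases hCγ : γ * Fintype.card G ≤ C.card
    · obtain ⟨W, a, hW1, hW2⟩ := hstep G A C hA (fun x hx => (Finset.mem_filter.mp hx).2) hCγ hα
      set A' : Finset W := univ.filter (fun x : W => a + (x : G) ∈ A) with hA'
      have hNW : (0 : ℝ) < Fintype.card W := by exact_mod_cast Fintype.card_pos
      have e : Nat.card {x : W // a + (x : G) ∈ A} = A'.card := by
        rw [Nat.card_eq_fintype_card, Fintype.card_subtype]
      rw [e, Nat.card_eq_fintype_card (α := W)] at hW2
      have hd : (17 / 16) * ((A.card : ℝ) / Fintype.card G) ≤ (A'.card : ℝ) / Fintype.card W := by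
        rwa [le_div_iff₀ hNW]
      have hpos : 0 < (A.card : ℝ) / Fintype.card G := by positivity
      have hA'ne : A'.Nonempty := by
        rw [← Finset.card_pos]
        have : (0:ℝ) < (A'.card : ℝ) := lt_of_lt_of_le (by positivity) hW2
        exact_mod_cast this
      obtain ⟨W', v', h3, h4⟩ := ih W A' hA'ne (by linarith) (by
        refine lt_of_lt_of_le h1 ?_
        rw [pow_succ, mul_assoc]
        gcongr)
      refine ⟨W'.map W.subtype, a + a + v', ?_, ?_⟩
      · rw [Submodule.finrank_map_subtype_eq]
        push_cast
        linarith
      · have hinj : Function.Injective W.subtype := Submodule.injective_subtype W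
        let E := Submodule.equivMapOfInjective W.subtype hinj W'
        have c1 : Nat.card (W'.map W.subtype) = Nat.card W' := (Nat.card_congr E.toEquiv).symm
        rw [c1]
        refine le_trans ?_ h4
        have hEc : ∀ x : W', ((E x : W'.map W.subtype) : G) = ((x : W) : G) := fun x => rfl
        have c2 : Nat.card {x : W'.map W.subtype // ∀ c ∈ A, ∀ b ∈ A, c + b ≠ a + a + v' + (x : G)}
            ≤ Nat.card {x : W' // ∀ c ∈ A', ∀ b ∈ A', c + b ≠ v' + (x : W)} := by
          refine Nat.card_le_card_of_injective
            (fun x => ⟨E.symm x.1, ?_⟩) ?_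
          · intro c hc b hb hcb
            have hc' := (Finset.mem_filter.mp hc).2
            have hb' := (Finset.mem_filter.mp hb).2
            refine x.2 _ hc' _ hb' ?_
            have h5 := congrArg (fun z : W => (z : G)) hcb
            simp only [Submodule.coe_add] at h5
            have h6 := hEc (E.symm x.1)
            rw [LinearEquiv.apply_symm_apply] at h6
            rw [h6]
            calc a + (c : G) + (a + b) = a + a + (c + b) := by abel
              _ = _ := by rw [h5]; abel
          · intro x y hxy
            have := congrArg Subtype.val hxy
            exact Subtype.ext (E.symm.injective this)
        exact_mod_cast c2
    · refine ⟨⊤, 0, ?_, ?_⟩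
      · rw [finrank_top]
        simp only [sub_self]; positivity
      · push Not at hCγ
        have c1 : Nat.card (⊤ : Submodule (ZMod q) G) = Fintype.card G := by
          rw [Nat.card_congr (Submodule.topEquiv (R := ZMod q) (M := G)).toEquiv, Nat.card_eq_fintype_card]
        have c2 : Nat.card {x : (⊤ : Submodule (ZMod q) G) // ∀ a ∈ A, ∀ b ∈ A, a + b ≠ 0 + (x : G)} ≤ C.card := by
          have : C.card = Nat.card {x : G // ∀ a ∈ A, ∀ b ∈ A, a + b ≠ x} := by
            rw [Nat.card_eq_fintype_card, Fintype.card_subtype]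
          rw [this]
          refine Nat.card_le_card_of_injective (fun x => ⟨(x.1 : G), by simpa using x.2⟩) ?_
          intro x y hxy
          have h7 : ((x.1 : G)) = (y.1 : G) := by simpa using hxy
          exact Subtype.ext (Subtype.ext h7)
        rw [c1]
        exact le_trans (by exact_mod_cast c2) hCγ.le

lemma km_lo_pos (δ : ℝ) (h0 : 0 < δ) (h1 : δ ≤ 1) : 0.69 < Real.log (2 / δ) := by
  have : Real.log 2 ≤ Real.log (2 / δ) := by
    apply Real.log_le_log (by norm_num)
    rw [le_div_iff₀ h0]; linarith
  linarith [Real.log_two_gt_d9]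

set_option maxHeartbeats 2000000 in
lemma km_params (α γ : ℝ) (hα0 : 0 < α) (hα1 : α ≤ 1) (hγ0 : 0 < γ) (hγ1 : γ ≤ 1) :
    ∃ m k l n : ℕ, Even m ∧ 24 ≤ m ∧ (3 / 2 : ℝ) ^ m ≤ γ * 2 ^ m ∧ 0 < k ∧ 16 ≤ 4 ^ k * α ∧
      0 < l ∧ 4 ≤ Real.exp (l * (1 / (80 * k)) ^ 2 / 2) * (1 / (80 * k) * α ^ m) ∧
      1 < (17 / 16 : ℝ) ^ n * α ∧ 0 ≤ 8 * Real.log (2 / (α ^ m) ^ l) ∧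
      n * (8 * Real.log (2 / (α ^ m) ^ l)) ≤
        10 ^ 12 * Real.log (2 / α) ^ 5 * Real.log (2 / γ) ^ 2 := by
  set a := Real.log (2 / α) with ha
  set g := Real.log (2 / γ) with hg
  have ha0 : 0.69 < a := km_lo_pos α hα0 hα1
  have hg0 : 0.69 < g := km_lo_pos γ hγ0 hγ1
  have hea : Real.exp a = 2 / α := Real.exp_log (by positivity)
  have heg : Real.exp g = 2 / γ := Real.exp_log (by positivity)
  set m := 2 * ⌈16 * g⌉₊ with hm
  set k := ⌈4 * a⌉₊ with hk
  set l := ⌈12800 * (k:ℝ) ^ 2 * (6 + k + m * a)⌉₊ with hl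
  set n := ⌈20 * a⌉₊ with hn
  have hm1 : 32 * g ≤ m := by rw [hm]; push_cast; linarith [Nat.le_ceil (16 * g)]
  have hm2 : (m:ℝ) ≤ 35 * g := by
    rw [hm]; push_cast; linarith [Nat.ceil_lt_add_one (show 0 ≤ 16 * g by linarith)]
  have hk1 : 4 * a ≤ k := Nat.le_ceil _
  have hk2 : (k:ℝ) ≤ 6 * a := by linarith [Nat.ceil_lt_add_one (show 0 ≤ 4 * a by linarith)]
  have hn1 : 20 * a ≤ n := Nat.le_ceil _
  have hn2 : (n:ℝ) ≤ 22 * a := by linarith [Nat.ceil_lt_add_one (show 0 ≤ 20 * a by linarith)]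
  have hk0 : (0:ℝ) < k := by linarith
  have hm0 : (0:ℝ) < m := by linarith
  have hma : 0 < m * a := by positivity
  have hl1 : 12800 * (k:ℝ) ^ 2 * (6 + k + m * a) ≤ l := Nat.le_ceil _
  have hl2 : (l:ℝ) ≤ 12800 * (k:ℝ) ^ 2 * (6 + k + m * a) + 1 :=
    (Nat.ceil_lt_add_one (by positivity)).le
  have hl0 : (0:ℝ) < l := lt_of_lt_of_le (by positivity) hl1
  have hag : 0.47 < a * g := by nlinarith
  have hl3 : (l:ℝ) ≤ 4 * 10 ^ 7 * (a ^ 3 * g) := by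
    have b1 : 6 + k + m * a ≤ 71 * (a * g) := by
      have : m * a ≤ 35 * g * a := by gcongr
      nlinarith
    have b2 : (k:ℝ) ^ 2 ≤ (6 * a) ^ 2 := by gcongr
    have b3 : 12800 * (k:ℝ) ^ 2 * (6 + k + m * a) ≤ 12800 * (6 * a) ^ 2 * (71 * (a * g)) := by
      gcongr
    have b4 : 1 ≤ 16 * (a ^ 3 * g) := by
      have : 0.47 ≤ a ^ 2 := by nlinarith
      nlinarith
    nlinarith
  have hlog : Real.log (2 / (α ^ m) ^ l) ≤ 2 * (m * l * a) := by
    rw [Real.log_div (by norm_num) (by positivity), Real.log_pow, Real.log_pow]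
    have e : Real.log α = Real.log 2 - a := by
      rw [ha, Real.log_div (by norm_num) hα0.ne']; ring
    rw [e]
    have hln2 := Real.log_two_gt_d9
    have hln2' := Real.log_two_lt_d9
    have hl1' : (1:ℝ) ≤ l := by
      exact_mod_cast Nat.one_le_iff_ne_zero.mpr (by rintro h; rw [h] at hl0; simp at hl0)
    have hm1' : 22 ≤ (m:ℝ) := by linarith
    have : 22 ≤ (m:ℝ) * l := by nlinarith
    have h3 : 1 ≤ (m:ℝ) * l * a := by nlinarith
    have h8 : 0 ≤ (l:ℝ) * (m * Real.log 2) := by positivity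
    have h9 : (l:ℝ) * (m * (Real.log 2 - a)) = l * (m * Real.log 2) - m * l * a := by ring
    rw [h9]
    linarith
  have hlog0 : 0 ≤ Real.log (2 / (α ^ m) ^ l) := by
    apply Real.log_nonneg
    rw [le_div_iff₀ (by positivity)]
    have : (α ^ m) ^ l ≤ 1 := pow_le_one₀ (by positivity) (pow_le_one₀ hα0.le hα1)
    linarith
  refine ⟨m, k, l, n, even_two_mul _, ?_, ?_, by exact_mod_cast hk0, ?_, by exact_mod_cast hl0, ?_, ?_, ?_, ?_⟩
  · have : 11 < ⌈16 * g⌉₊ := by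
      rw [Nat.lt_ceil]; push_cast; linarith
    omega
  · have h1 : (1:ℝ) / 4 ≤ Real.log (4 / 3) := by
      have := Real.one_sub_inv_le_log_of_pos (show (0:ℝ) < 4 / 3 by norm_num)
      norm_num at this ⊢; linarith
    have h2 : 2 / γ ≤ (4 / 3 : ℝ) ^ m := by
      rw [← heg, ← Real.exp_log (show (0:ℝ) < (4 / 3) ^ m by positivity), Real.exp_le_exp, Real.log_pow]
      nlinarith
    have h3 : 1 ≤ γ * (4 / 3 : ℝ) ^ m := by
      rw [div_le_iff₀ hγ0] at h2; linarith
    have h4 : (2:ℝ) ^ m = (4 / 3) ^ m * (3 / 2) ^ m := by rw [← mul_pow]; norm_num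
    rw [h4, ← mul_assoc]
    exact le_mul_of_one_le_left (by positivity) h3
  · have h1 : (1:ℝ) ≤ Real.log 4 := by
      have : (4:ℝ) = 2 ^ 2 := by norm_num
      rw [this, Real.log_pow]; push_cast; linarith [Real.log_two_gt_d9]
    have h2 : Real.exp (a + 3 * a) ≤ 4 ^ k := by
      rw [← Real.exp_log (show (0:ℝ) < 4 ^ k by positivity), Real.exp_le_exp, Real.log_pow]
      nlinarith
    have h3 : Real.exp (3 * a) = (2 / α) ^ 3 := by rw [← hea, ← Real.exp_nat_mul]; norm_num
    rw [Real.exp_add, h3, hea] at h2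
    have h4 : 2 ≤ 2 / α := by rw [le_div_iff₀ hα0]; linarith
    have h5 : (8:ℝ) ≤ (2 / α) ^ 3 := by
      calc (8:ℝ) = 2 ^ 3 := by norm_num
        _ ≤ _ := by gcongr
    calc (16:ℝ) = (2 / α * 8) * α := by field_simp; norm_num
      _ ≤ (2 / α * (2 / α) ^ 3) * α := by gcongr
      _ ≤ _ := by gcongr
  · have h1 : 6 + k + m * a ≤ l * (1 / (80 * k)) ^ 2 / 2 := by
      have : (l:ℝ) * (1 / (80 * k)) ^ 2 / 2 = l / (12800 * k ^ 2) := by field_simp; norm_num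
      rw [this, le_div_iff₀ (by positivity)]
      linarith
    have h2 := Real.exp_le_exp.mpr h1
    have h3 : Real.exp (6 + k + m * a) = Real.exp 6 * Real.exp k * (2 / α) ^ m := by
      rw [Real.exp_add, Real.exp_add, ← hea, ← Real.exp_nat_mul]
    have h4 : (320:ℝ) ≤ Real.exp 6 := by
      have : Real.exp 6 = Real.exp 1 ^ 6 := by rw [← Real.exp_nat_mul]; norm_num
      rw [this]
      calc (320:ℝ) ≤ 2.7 ^ 6 := by norm_num
        _ ≤ _ := by gcongr; linarith [Real.exp_one_gt_d9]
    have h5 : (k:ℝ) ≤ Real.exp k := by linarith [Real.add_one_le_exp (k:ℝ)]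
    have h6 : (1 / α) ^ m ≤ (2 / α) ^ m := by gcongr; norm_num
    calc (4:ℝ) = (320 * k * (1 / α) ^ m) * (1 / (80 * k) * α ^ m) := by
          rw [div_pow, one_pow]; field_simp; norm_num
      _ ≤ (Real.exp 6 * Real.exp k * (2 / α) ^ m) * (1 / (80 * k) * α ^ m) := by gcongr
      _ ≤ _ := by rw [← h3]; gcongr
  · have h1 : (1:ℝ) / 17 ≤ Real.log (17 / 16) := by
      have := Real.one_sub_inv_le_log_of_pos (show (0:ℝ) < 17 / 16 by norm_num)
      norm_num at this ⊢; linarith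
    have h2 : 2 / α ≤ (17 / 16 : ℝ) ^ n := by
      rw [← hea, ← Real.exp_log (show (0:ℝ) < (17 / 16) ^ n by positivity), Real.exp_le_exp, Real.log_pow]
      nlinarith
    rw [div_le_iff₀ hα0] at h2; linarith
  · positivity
  · calc n * (8 * Real.log (2 / (α ^ m) ^ l)) ≤ (22 * a) * (8 * (2 * ((35 * g) * (4 * 10 ^ 7 * (a ^ 3 * g)) * a))) := by
          gcongr
          refine hlog.trans ?_
          gcongr
      _ = (22 * 8 * 2 * 35 * 4 * 10 ^ 7) * (a ^ 5 * g ^ 2) := by ring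
      _ ≤ 10 ^ 12 * (a ^ 5 * g ^ 2) := by gcongr; norm_num
      _ = _ := by ring

/-- **Theorem 3 (sumsets nearly contain affine subspaces)**: there is a constant `C > 0` such that
for every prime `q`, every `n ≥ 1`, every nonempty `A ⊆ 𝔽_q^n` of density `α` and every
`γ ∈ (0,1]`, there is an affine subspace `V` of codimension at most `C ⌞α⌟^5 ⌞γ⌟^2` with
`|(A+A) ∩ V| ≥ (1-γ)|V|`. -/
theorem sumset_contains_affine_subspace :
    ∃ C : ℝ, 0 < C ∧
      ∀ (q n : ℕ) [Fact q.Prime], 0 < n →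
        ∀ A : Finset (Fin n → ZMod q), A.Nonempty →
          ∀ α : ℝ, α = (A.card : ℝ) / (q : ℝ) ^ n →
            ∀ γ : ℝ, 0 < γ → γ ≤ 1 →
              ∃ (W : Submodule (ZMod q) (Fin n → ZMod q)) (v : Fin n → ZMod q),
                ((n : ℝ) - Module.finrank (ZMod q) W) ≤ C * lo α ^ 5 * lo γ ^ 2 ∧
                (1 - γ) * ((affineCoset W v).card : ℝ) ≤
                  (((A + A) ∩ affineCoset W v).card : ℝ) := by
  refine ⟨10 ^ 12, by norm_num, ?_⟩
  intro q n _ hn A hA α hα γ hγ0 hγ1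
  have hcard : (Fintype.card (Fin n → ZMod q) : ℝ) = (q : ℝ) ^ n := by
    rw [Fintype.card_pi_const, ZMod.card]; push_cast; rfl
  have hdens : α = (A.card : ℝ) / Fintype.card (Fin n → ZMod q) := by rw [hα, hcard]
  have hpos : (0:ℝ) < Fintype.card (Fin n → ZMod q) := by exact_mod_cast Fintype.card_pos
  have hα0 : 0 < α := by
    rw [hdens]
    have : (0:ℝ) < A.card := by exact_mod_cast hA.card_pos
    positivity
  have hα1 : α ≤ 1 := by
    rw [hdens, div_le_one hpos]
    exact_mod_cast Finset.card_le_univ A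
  obtain ⟨m, k, l, N, p1, p2, p3, p4, p5, p6, p7, p8, p9, p10⟩ :=
    km_params α γ hα0 hα1 hγ0 hγ1
  obtain ⟨W, v, h1, h2⟩ := km_iter q α γ (8 * Real.log (2 / (α ^ m) ^ l)) p9
    (fun G _ _ _ A C hA hC hCγ hd =>
      km_step A C hA γ hC hCγ m k l p1 p2 p3 α hα0 hd p4 p5 p6 p7) N
    (Fin n → ZMod q) A hA hdens.le (by rw [← hdens]; exact p8)
  refine ⟨W, v, ?_, ?_⟩
  · rw [Module.finrank_fin_fun] at h1
    exact h1.trans p10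
  · have hmem : ∀ x, x ∈ affineCoset W v ↔ x - v ∈ W := by
      intro x; simp [affineCoset]
    have c1 : (affineCoset W v).card = Nat.card W := by
      rw [← Nat.card_eq_finsetCard]
      refine Nat.card_congr ⟨fun x => ⟨x.1 - v, hmem x.1 |>.1 x.2⟩,
        fun x => ⟨x.1 + v, (hmem _).2 (by simp)⟩, fun x => by simp, fun x => by simp⟩
    have c2 : (affineCoset W v \ (A + A)).card ≤
        Nat.card {x : W // ∀ a ∈ A, ∀ b ∈ A, a + b ≠ v + (x : Fin n → ZMod q)} := by
      rw [← Nat.card_eq_finsetCard]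
      refine Nat.card_le_card_of_injective (fun x => ⟨⟨x.1 - v, (hmem x.1).1 (Finset.mem_sdiff.1 x.2).1⟩,
        ?_⟩) ?_
      · intro a ha b hb hab
        apply (Finset.mem_sdiff.1 x.2).2
        rw [Finset.mem_add]
        exact ⟨a, ha, b, hb, by rw [hab]; simp⟩
      · intro x y hxy
        have h7 : (x.1 - v) = (y.1 - v) := by simpa using hxy
        exact Subtype.ext (sub_left_injective h7)
    have c3 := Finset.card_sdiff_add_card_inter (affineCoset W v) (A + A)
    rw [Finset.inter_comm] at c3
    have c4 : ((affineCoset W v \ (A + A)).card : ℝ) ≤ γ * Nat.card W :=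
      le_trans (by exact_mod_cast c2) h2
    have c5 : ((affineCoset W v \ (A + A)).card : ℝ) + ((A + A) ∩ affineCoset W v).card = Nat.card W := by
      rw [← c1]; exact_mod_cast c3
    rw [c1]
    linarith
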